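/- arXiv:1802.10309 — 2 statements merged into one kernel-verified Lean document; each statement's English description precedes it below -/
import Mathlib

section
/- In any execution of algorithm 𝒜 with parameter ε ∈ (0,1) on an instance with job set J, the total number of jobs rejected (by Rule 1 and Rule 2 together) is at most 2ε·|J|. -/
open Finset
open scoped Classical

/-- An execution of the flow-time algorithm 𝒜 with rejection parameter `ε` on an online
instance of `n` jobs over the machine set `M`.  Job `j` has release time `r j` and
processing time `p i j` on machine `i`; it is dispatched upon arrival to machine
`assign j`; `C j` is its completion time (or its rejection time if it is rejected),
`Ctilde j` its definitive finish time, `start j` its start time (when `started j`);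
`rej1 j` and `rej2 j` record whether `j` is rejected by Rule 1 resp. Rule 2, and
`cnt i t` is the Rule 2 counter `c_i` of machine `i` at time `t`.  The remaining
algorithmic rules are packaged in `FlowExec.Rules` below. -/
structure FlowExec (M : Type) [Fintype M] (n : ℕ) (ε : ℝ) where
  r : Fin n → ℝ
  p : M → Fin n → ℝ
  r_nonneg : ∀ j, 0 ≤ r j
  p_pos : ∀ i j, 0 < p i j
  assign : Fin n → M
  started : Fin n → Bool
  start : Fin n → ℝ
  C : Fin n → ℝ
  Ctilde : Fin n → ℝ
  rej1 : Fin n → Bool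
  rej2 : Fin n → Bool
  cnt : M → ℝ → ℕ
  rej_disjoint : ∀ j, ¬(rej1 j = true ∧ rej2 j = true)
  start_ge : ∀ j, started j = true → r j ≤ start j
  C_ge : ∀ j, r j ≤ C j
  Ctilde_ge : ∀ j, C j ≤ Ctilde j
  /-- a non-rejected job is executed non-preemptively for `p _ j` time units -/
  completes : ∀ j, rej1 j = false → rej2 j = false →
    started j = true ∧ C j = start j + p (assign j) j
  /-- Rule 1 interrupts and rejects a running job at the first moment that `1/ε` jobs
  have been dispatched to its machine during its execution -/
  rule1 : ∀ j, rej1 j = true →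
    started j = true ∧ start j ≤ C j ∧ C j < start j + p (assign j) j ∧
    (∃ ℓ, ℓ ≠ j ∧ assign ℓ = assign j ∧ r ℓ = C j) ∧
    (univ.filter (fun ℓ => assign ℓ = assign j ∧ start j < r ℓ ∧ r ℓ ≤ C j)).card
      = ⌈1 / ε⌉₊
  /-- a job rejected by Rule 2 is rejected while waiting in the queue: it never starts -/
  rule2_not_started : ∀ j, rej2 j = true → started j = false

namespace FlowExec

variable {M : Type} [Fintype M] {n : ℕ} {ε : ℝ}

/-- `U_i(t)`: the pending jobs dispatched to machine `i` at time `t`. -/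
noncomputable def U (E : FlowExec M n ε) (i : M) (t : ℝ) : Finset (Fin n) :=
  univ.filter (fun j => E.assign j = i ∧ E.r j ≤ t ∧ t < E.C j)

/-- The job(s) being executed on machine `i` at time `t`. -/
noncomputable def running (E : FlowExec M n ε) (i : M) (t : ℝ) : Finset (Fin n) :=
  univ.filter (fun j =>
    E.assign j = i ∧ E.started j = true ∧ E.start j ≤ t ∧ t < E.C j)

/-- `V_i(t)`: the jobs dispatched to `i` that are completed or rejected but not yet
definitively finished at time `t`. -/
noncomputable def V (E : FlowExec M n ε) (i : M) (t : ℝ) : Finset (Fin n) :=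
  univ.filter (fun j => E.assign j = i ∧ E.C j ≤ t ∧ t < E.Ctilde j)

/-- `R_i(t)`: the jobs rejected by Rule 2 that are not yet definitively finished. -/
noncomputable def R (E : FlowExec M n ε) (i : M) (t : ℝ) : Finset (Fin n) :=
  univ.filter (fun j =>
    E.assign j = i ∧ E.rej2 j = true ∧ E.C j ≤ t ∧ t < E.Ctilde j)

/-- The order `⪯` on the jobs waiting for machine `i`: non-decreasing processing time,
ties broken by earliest release time, then by index. -/
def pre (E : FlowExec M n ε) (i : M) (j ℓ : Fin n) : Prop :=
  E.p i j < E.p i ℓ ∨ (E.p i j = E.p i ℓ ∧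
    (E.r j < E.r ℓ ∨ (E.r j = E.r ℓ ∧ j ≤ ℓ)))

/-- The jobs waiting (pending but not being executed) on machine `i` at time `t`. -/
noncomputable def waiting (E : FlowExec M n ε) (i : M) (t : ℝ) : Finset (Fin n) :=
  E.U i t \ E.running i t

/-- `λ_{ij} = (1/ε)·p_{ij} + Σ_{ℓ ⪯ j} p_{iℓ} + Σ_{ℓ ≻ j} p_{ij}`, where `ℓ` ranges
over the jobs waiting on machine `i` at the arrival of `j`, together with `j` itself. -/
noncomputable def lamI (E : FlowExec M n ε) (i : M) (j : Fin n) : ℝ :=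
  (1 / ε) * E.p i j + E.p i j +
    (∑ ℓ ∈ (E.waiting i (E.r j)).filter (fun ℓ => ℓ ≠ j ∧ E.pre i ℓ j), E.p i ℓ) +
    ((E.waiting i (E.r j)).filter (fun ℓ => ℓ ≠ j ∧ ¬ E.pre i ℓ j)).card * E.p i j

/-- The completion time of a pending job `j ∈ U_i(t)`, estimated at time `t` assuming
that no further job is released after time `t`. -/
noncomputable def estC (E : FlowExec M n ε) (i : M) (t : ℝ) (j : Fin n) : ℝ :=
  if j ∈ E.running i t then E.start j + E.p i j
  else t + (∑ k ∈ E.running i t, (E.start k + E.p i k - t)) +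
    ∑ ℓ ∈ (E.waiting i t).filter (fun ℓ => E.pre i ℓ j), E.p i ℓ

/-- The algorithmic rules of 𝒜: the dispatching policy (each arriving job goes to a
machine minimizing `λ_{ij}`); the scheduling policy (whenever a machine becomes idle it
starts the `⪯`-first waiting job, running one job at a time, never idling while jobs
are pending); the behaviour of the Rule 2 counters (incremented at each dispatch and
reset when reaching `1 + 1/ε`, at which point the waiting job with the largest
processing time is rejected); and the defining formula of the definitive finish times. -/
def Rules (E : FlowExec M n ε) : Prop :=
  (∀ (j : Fin n) (i : M), E.lamI (E.assign j) j ≤ E.lamI i j) ∧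
  (∀ j : Fin n, E.started j = true →
    ∀ ℓ ∈ E.waiting (E.assign j) (E.start j), E.pre (E.assign j) j ℓ) ∧
  (∀ (i : M) (t : ℝ), (E.running i t).card ≤ 1) ∧
  (∀ (i : M) (t : ℝ), (E.U i t).Nonempty → (E.running i t).Nonempty) ∧
  (∀ (i : M) (t : ℝ), 0 ≤ t →
    (E.cnt i t : ℤ) =
      ((univ.filter (fun j => E.assign j = i ∧ E.r j ≤ t)).card : ℤ) -
      (1 + (⌈1 / ε⌉₊ : ℤ)) *
        ((univ.filter (fun j =>
          E.assign j = i ∧ E.rej2 j = true ∧ E.C j ≤ t)).card : ℤ)) ∧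
  (∀ (i : M) (t : ℝ), E.cnt i t < 1 + ⌈1 / ε⌉₊) ∧
  (∀ j : Fin n, E.rej2 j = true →
    (∃ ℓ, E.assign ℓ = E.assign j ∧ E.r ℓ = E.C j) ∧
    ∀ ℓ ∈ E.waiting (E.assign j) (E.C j), E.p (E.assign j) ℓ ≤ E.p (E.assign j) j) ∧
  (∀ j : Fin n, E.Ctilde j = E.C j +
    (∑ k ∈ univ.filter (fun k => E.rej1 k = true ∧ E.assign k = E.assign j ∧
        E.r j ≤ E.C k ∧ E.C k ≤ E.C j),
      (E.start k + E.p (E.assign j) k - E.C k)) +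
    (if E.rej2 j = true then
      (∑ k ∈ E.running (E.assign j) (E.C j),
        (E.start k + E.p (E.assign j) k - E.C j)) +
      (∑ ℓ ∈ (E.waiting (E.assign j) (E.C j)).erase j, E.p (E.assign j) ℓ) +
      E.p (E.assign j) j
    else 0))

end FlowExec

namespace FlowExec

variable {M : Type} [Fintype M] {n : ℕ} {ε : ℝ}

/-- The sets of jobs counted by Rule 1 are pairwise disjoint, hence Rule 1 rejects at most one
job for every `⌈1 / ε⌉₊` dispatched jobs. -/
theorem ceil_mul_card_rej1_le (E : FlowExec M n ε)
    (hrun : ∀ (i : M) (t : ℝ), (E.running i t).card ≤ 1) :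
    ⌈1 / ε⌉₊ * (univ.filter (fun j => E.rej1 j = true)).card ≤ n := by
  set S : Fin n → Finset (Fin n) := fun j =>
    univ.filter (fun ℓ => E.assign ℓ = E.assign j ∧ E.start j < E.r ℓ ∧ E.r ℓ ≤ E.C j) with hS
  have hdisj : ∀ j ∈ univ.filter (fun j => E.rej1 j = true),
      ∀ k ∈ univ.filter (fun j => E.rej1 j = true), j ≠ k → Disjoint (S j) (S k) := by
    intro j hj k hk hjk
    rw [Finset.disjoint_left]
    intro ℓ hℓj hℓk
    simp only [hS, mem_filter, mem_univ, true_and] at hj hk hℓj hℓk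
    obtain ⟨haj, hsj, hCj⟩ := hℓj
    obtain ⟨hak, hsk, hCk⟩ := hℓk
    have hlt : max (E.start j) (E.start k) < E.r ℓ := max_lt hsj hsk
    refine hjk (Finset.card_le_one.mp
      (hrun (E.assign ℓ) (max (E.start j) (E.start k))) j ?_ k ?_)
    · simp only [running, mem_filter, mem_univ, true_and]
      exact ⟨haj.symm, (E.rule1 j hj).1, le_max_left _ _, hlt.trans_le hCj⟩
    · simp only [running, mem_filter, mem_univ, true_and]
      exact ⟨hak.symm, (E.rule1 k hk).1, le_max_right _ _, hlt.trans_le hCk⟩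
  have hcard : ∀ j ∈ univ.filter (fun j => E.rej1 j = true), (S j).card = ⌈1 / ε⌉₊ := by
    intro j hj
    exact (E.rule1 j (mem_filter.mp hj).2).2.2.2.2
  calc ⌈1 / ε⌉₊ * (univ.filter (fun j => E.rej1 j = true)).card
      = ((univ.filter (fun j => E.rej1 j = true)).biUnion S).card := by
        rw [Finset.card_biUnion hdisj, Finset.sum_congr rfl hcard, Finset.sum_const,
          smul_eq_mul, mul_comm]
    _ ≤ n := (Finset.card_le_univ _).trans_eq (Fintype.card_fin n)

/-- Since the Rule 2 counters stay non-negative, Rule 2 rejects at most one job for every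
`1 + ⌈1 / ε⌉₊` dispatched jobs. -/
theorem succ_ceil_mul_card_rej2_le (E : FlowExec M n ε)
    (hcnt : ∀ (i : M) (t : ℝ), 0 ≤ t →
      (E.cnt i t : ℤ) =
        ((univ.filter (fun j => E.assign j = i ∧ E.r j ≤ t)).card : ℤ) -
        (1 + (⌈1 / ε⌉₊ : ℤ)) *
          ((univ.filter (fun j =>
            E.assign j = i ∧ E.rej2 j = true ∧ E.C j ≤ t)).card : ℤ)) :
    (1 + ⌈1 / ε⌉₊) * (univ.filter (fun j => E.rej2 j = true)).card ≤ n := by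
  have hC : ∀ j, 0 ≤ E.C j := fun j => (E.r_nonneg j).trans (E.C_ge j)
  have hCT : ∀ j, E.C j ≤ ∑ k, E.C k := fun j =>
    Finset.single_le_sum (fun k _ => hC k) (mem_univ j)
  have hmachine : ∀ i : M,
      (1 + ⌈1 / ε⌉₊) * ((univ.filter (fun j => E.rej2 j = true)).filter
        (fun j => E.assign j = i)).card ≤ (univ.filter (fun j => E.assign j = i)).card := by
    intro i
    have h := hcnt i (∑ k, E.C k) (Finset.sum_nonneg fun k _ => hC k)
    have h1 : univ.filter (fun j => E.assign j = i ∧ E.r j ≤ ∑ k, E.C k)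
        = univ.filter (fun j => E.assign j = i) :=
      Finset.filter_congr fun j _ => and_iff_left ((E.C_ge j).trans (hCT j))
    have h2 : univ.filter (fun j => E.assign j = i ∧ E.rej2 j = true ∧ E.C j ≤ ∑ k, E.C k)
        = (univ.filter (fun j => E.rej2 j = true)).filter (fun j => E.assign j = i) := by
      ext j
      simp [hCT j, and_comm]
    rw [h1, h2] at h
    zify
    linarith [Int.natCast_nonneg (E.cnt i (∑ k, E.C k))]
  calc (1 + ⌈1 / ε⌉₊) * (univ.filter (fun j => E.rej2 j = true)).card
      = ∑ i, (1 + ⌈1 / ε⌉₊) * ((univ.filter (fun j => E.rej2 j = true)).filter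
          (fun j => E.assign j = i)).card := by
        rw [← Finset.mul_sum, ← Finset.card_eq_sum_card_fiberwise (f := E.assign) (fun j _ => mem_coe.mpr (mem_univ _))]
    _ ≤ ∑ i, (univ.filter (fun j => E.assign j = i)).card :=
        Finset.sum_le_sum fun i _ => hmachine i
    _ = n := by
        rw [← Finset.card_eq_sum_card_fiberwise (f := E.assign) (fun j _ => mem_coe.mpr (mem_univ _)), Finset.card_univ,
          Fintype.card_fin]

end FlowExec

/-- In any execution of algorithm 𝒜 with parameter `ε ∈ (0,1)` on an instance with `n`
jobs, the total number of jobs rejected (by Rule 1 and Rule 2 together) is at most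
`2ε·n`. -/
theorem rejected_fraction (M : Type) [Fintype M] (n : ℕ) (ε : ℝ)
    (hε0 : 0 < ε) (hε1 : ε < 1) (E : FlowExec M n ε) (hE : E.Rules) :
    (((Finset.univ : Finset (Fin n)).filter
        (fun j => E.rej1 j = true ∨ E.rej2 j = true)).card : ℝ) ≤ 2 * ε * n := by
  obtain ⟨-, -, hrun, -, hcnt, -⟩ := hE
  have h1 : (⌈1 / ε⌉₊ : ℝ) * ((univ.filter (fun j => E.rej1 j = true)).card : ℝ) ≤ n := by
    exact_mod_cast E.ceil_mul_card_rej1_le hrun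
  have h2 : (1 + (⌈1 / ε⌉₊ : ℝ)) * ((univ.filter (fun j => E.rej2 j = true)).card : ℝ) ≤ n := by
    exact_mod_cast E.succ_ceil_mul_card_rej2_le hcnt
  have hK : 1 / ε ≤ (⌈1 / ε⌉₊ : ℝ) := Nat.le_ceil _
  have hbound : ∀ {K a : ℝ}, 1 / ε ≤ K → 0 ≤ a → K * a ≤ n → a ≤ ε * n := by
    intro K a hK ha h
    have := (mul_le_mul_of_nonneg_right hK ha).trans h
    rwa [one_div, inv_mul_le_iff₀ hε0] at this
  have hunion : (((Finset.univ : Finset (Fin n)).filter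
      (fun j => E.rej1 j = true ∨ E.rej2 j = true)).card : ℝ) ≤
      ((univ.filter (fun j => E.rej1 j = true)).card : ℝ) +
        ((univ.filter (fun j => E.rej2 j = true)).card : ℝ) := by
    rw [Finset.filter_or]
    exact_mod_cast Finset.card_union_le _ _
  linarith [hbound hK (Nat.cast_nonneg _) h1,
    hbound (hK.trans (by linarith)) (Nat.cast_nonneg _) h2]
end

section
/- In any execution of the speed-scaling algorithm 𝒜 with parameter ε ∈ (0,1) on an instance with job set J, the total weight of the rejected jobs is at most ε·Σ_{j∈J} w_j. -/
open Finset
open scoped Classical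

/-- An execution of the speed-scaling algorithm 𝒜 (for weighted flow time plus energy)
with parameters `α` (power exponent), `ε` (rejection parameter) and `γ` (speed
constant), on an online instance given by a finite set `jobs` of jobs over the machine
set `M`.  Job `j` has weight `w j`, release time `r j` and volume `p i j` on machine
`i`; it is dispatched upon arrival to machine `assign j`; `start j` is its start time
(when `started j`), `speed j` the constant speed at which it is run, `C j` its
completion (or rejection) time, `Ctilde j` its definitive finish time, and `rej j`
records whether it is rejected.  The algorithmic rules are packaged in
`SpeedExec.Rules` below. -/
structure SpeedExec (M : Type) [Fintype M] (α ε γ : ℝ) where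
  jobs : Finset ℕ
  r : ℕ → ℝ
  w : ℕ → ℝ
  p : M → ℕ → ℝ
  r_nonneg : ∀ j ∈ jobs, 0 ≤ r j
  w_pos : ∀ j ∈ jobs, 0 < w j
  p_pos : ∀ (i : M), ∀ j ∈ jobs, 0 < p i j
  assign : ℕ → M
  started : ℕ → Bool
  start : ℕ → ℝ
  speed : ℕ → ℝ
  C : ℕ → ℝ
  Ctilde : ℕ → ℝ
  rej : ℕ → Bool
  start_ge : ∀ j ∈ jobs, started j = true → r j ≤ start j
  C_ge : ∀ j ∈ jobs, r j ≤ C j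
  Ctilde_ge : ∀ j ∈ jobs, C j ≤ Ctilde j
  speed_pos : ∀ j ∈ jobs, started j = true → 0 < speed j
  /-- a non-rejected job is executed non-preemptively at constant speed until completion -/
  completes : ∀ j ∈ jobs, rej j = false →
    started j = true ∧ C j = start j + p (assign j) j / speed j
  /-- only the running job is rejected, before its completion -/
  rej_running : ∀ j ∈ jobs, rej j = true →
    started j = true ∧ start j ≤ C j ∧ C j < start j + p (assign j) j / speed j

namespace SpeedExec

variable {M : Type} [Fintype M] {α ε γ : ℝ}

/-- `U_i(t)`: the pending jobs dispatched to machine `i` at time `t`. -/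
noncomputable def U (E : SpeedExec M α ε γ) (i : M) (t : ℝ) : Finset ℕ :=
  E.jobs.filter (fun j => E.assign j = i ∧ E.r j ≤ t ∧ t < E.C j)

/-- The job(s) being executed on machine `i` at time `t`. -/
noncomputable def running (E : SpeedExec M α ε γ) (i : M) (t : ℝ) : Finset ℕ :=
  E.jobs.filter (fun j =>
    E.assign j = i ∧ E.started j = true ∧ E.start j ≤ t ∧ t < E.C j)

/-- The jobs waiting (pending but not being executed) on machine `i` at time `t`. -/
noncomputable def waiting (E : SpeedExec M α ε γ) (i : M) (t : ℝ) : Finset ℕ :=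
  E.U i t \ E.running i t

/-- The density `δ_{ij} = w_j / p_{ij}`. -/
noncomputable def dens (E : SpeedExec M α ε γ) (i : M) (j : ℕ) : ℝ :=
  E.w j / E.p i j

/-- The order `⪯` on the jobs waiting for machine `i`: non-increasing density, ties
broken by earliest release time, then by index. -/
def pre (E : SpeedExec M α ε γ) (i : M) (j ℓ : ℕ) : Prop :=
  E.dens i ℓ < E.dens i j ∨ (E.dens i j = E.dens i ℓ ∧
    (E.r j < E.r ℓ ∨ (E.r j = E.r ℓ ∧ j ≤ ℓ)))

/-- `q_{iℓ}(t)`: the remaining volume of job `ℓ` on machine `i` at time `t`. -/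
noncomputable def q (E : SpeedExec M α ε γ) (i : M) (ℓ : ℕ) (t : ℝ) : ℝ :=
  if E.started ℓ = true ∧ E.start ℓ ≤ t then
    E.p i ℓ - E.speed ℓ * (min t (E.C ℓ) - E.start ℓ)
  else E.p i ℓ

/-- `V_i(t)`: the total fractional weight `Σ_ℓ w_ℓ q_{iℓ}(t)/p_{iℓ}` of the jobs
dispatched to machine `i` that are not yet definitively finished at time `t`. -/
noncomputable def V (E : SpeedExec M α ε γ) (i : M) (t : ℝ) : ℝ :=
  ∑ ℓ ∈ E.jobs.filter (fun ℓ => E.assign ℓ = i ∧ E.r ℓ ≤ t ∧ t < E.Ctilde ℓ),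
    E.w ℓ * E.q i ℓ t / E.p i ℓ

/-- The suffix weight `W_ℓ = Σ_{ℓ' ⪰ ℓ} w_{ℓ'}` over the jobs waiting on machine `i`
at the arrival of job `j` (together with `j` itself). -/
noncomputable def Wsuf (E : SpeedExec M α ε γ) (i : M) (j ℓ : ℕ) : ℝ :=
  ∑ ℓ' ∈ (insert j (E.waiting i (E.r j))).filter (fun ℓ' => E.pre i ℓ ℓ'), E.w ℓ'

/-- `λ_{ij} = w_j (p_{ij}/ε + Σ_{ℓ⪯j} p_{iℓ}/(γ W_ℓ^{1/α})) +
(Σ_{ℓ≻j} w_ℓ)·p_{ij}/(γ W_j^{1/α})`, where `ℓ` ranges over the jobs waiting on machine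
`i` at the arrival of `j`, together with `j` itself. -/
noncomputable def lamI (E : SpeedExec M α ε γ) (i : M) (j : ℕ) : ℝ :=
  E.w j * (E.p i j / ε +
      ∑ ℓ ∈ (insert j (E.waiting i (E.r j))).filter (fun ℓ => E.pre i ℓ j),
        E.p i ℓ / (γ * (E.Wsuf i j ℓ) ^ (1 / α))) +
    (∑ ℓ ∈ (E.waiting i (E.r j)).filter (fun ℓ => ℓ ≠ j ∧ ¬ E.pre i ℓ j), E.w ℓ) *
      E.p i j / (γ * (E.Wsuf i j j) ^ (1 / α))

/-- The algorithmic rules of 𝒜: the dispatching policy (each arriving job goes to a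
machine minimizing `λ_{ij}`); the scheduling policy (whenever a machine becomes idle it
starts the `⪯`-first waiting job at constant speed `γ (Σ_{ℓ ∈ U_i(t)} w_ℓ)^{1/α}`,
running one job at a time and never idling while jobs are pending); the rejection
policy (a running job `k` is interrupted and rejected at the first moment when the
total weight dispatched to its machine during its execution exceeds `w_k/ε`); and the
defining formula of the definitive finish times. -/
def Rules (E : SpeedExec M α ε γ) : Prop :=
  (∀ j ∈ E.jobs, ∀ i : M, E.lamI (E.assign j) j ≤ E.lamI i j) ∧
  (∀ j ∈ E.jobs, E.started j = true →
    ∀ ℓ ∈ E.waiting (E.assign j) (E.start j), E.pre (E.assign j) j ℓ) ∧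
  (∀ (i : M) (t : ℝ), (E.running i t).card ≤ 1) ∧
  (∀ (i : M) (t : ℝ), (E.U i t).Nonempty → (E.running i t).Nonempty) ∧
  (∀ j ∈ E.jobs, E.started j = true →
    E.speed j = γ * (∑ ℓ ∈ E.U (E.assign j) (E.start j), E.w ℓ) ^ (1 / α)) ∧
  (∀ k ∈ E.jobs, E.rej k = true →
    (∃ ℓ ∈ E.jobs, E.assign ℓ = E.assign k ∧ E.r ℓ = E.C k) ∧
    (E.w k / ε <
      ∑ ℓ ∈ E.jobs.filter (fun ℓ =>
        E.assign ℓ = E.assign k ∧ E.start k < E.r ℓ ∧ E.r ℓ ≤ E.C k), E.w ℓ) ∧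
    (∀ t : ℝ, E.start k ≤ t → t < E.C k →
      (∑ ℓ ∈ E.jobs.filter (fun ℓ =>
        E.assign ℓ = E.assign k ∧ E.start k < E.r ℓ ∧ E.r ℓ ≤ t), E.w ℓ)
        ≤ E.w k / ε)) ∧
  (∀ j ∈ E.jobs, E.rej j = false → E.started j = true →
    ∀ t : ℝ, E.start j ≤ t → t < E.C j →
      (∑ ℓ ∈ E.jobs.filter (fun ℓ =>
        E.assign ℓ = E.assign j ∧ E.start j < E.r ℓ ∧ E.r ℓ ≤ t), E.w ℓ)
        ≤ E.w j / ε) ∧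
  (∀ j ∈ E.jobs, E.Ctilde j = E.C j +
    ∑ k ∈ E.jobs.filter (fun k => E.rej k = true ∧ E.assign k = E.assign j ∧
        E.r j ≤ E.C k ∧ E.C k ≤ E.C j),
      E.q (E.assign j) k (E.C k) / E.speed k)

end SpeedExec

/-- Two jobs of one machine whose execution intervals share an interior or right end point
are equal. -/
theorem SpeedExec.eq_of_mem_execution {M : Type} [Fintype M] {α ε γ : ℝ}
    (E : SpeedExec M α ε γ) {i : M} (hcard : ∀ t : ℝ, (E.running i t).card ≤ 1)
    {j k : ℕ} (hj : j ∈ E.jobs) (hk : k ∈ E.jobs) (hji : E.assign j = i)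
    (hki : E.assign k = i) (hjs : E.started j = true) (hks : E.started k = true) {t : ℝ}
    (hj₁ : E.start j < t) (hj₂ : t ≤ E.C j) (hk₁ : E.start k < t) (hk₂ : t ≤ E.C k) :
    j = k := by
  have hlt : max (E.start j) (E.start k) < t := max_lt hj₁ hk₁
  refine Finset.card_le_one.mp (hcard (max (E.start j) (E.start k))) j ?_ k ?_
  · exact Finset.mem_filter.mpr ⟨hj, hji, hjs, le_max_left _ _, hlt.trans_le hj₂⟩
  · exact Finset.mem_filter.mpr ⟨hk, hki, hks, le_max_right _ _, hlt.trans_le hk₂⟩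

/-- In any execution of the speed-scaling algorithm 𝒜 with parameter `ε ∈ (0,1)`, the
total weight of the rejected jobs is at most `ε` times the total weight of all jobs. -/
theorem rejected_weight_fraction (M : Type) [Fintype M] (α ε γ : ℝ)
    (hα : 1 < α) (hε0 : 0 < ε) (hε1 : ε < 1) (hγ : 0 < γ)
    (E : SpeedExec M α ε γ) (hE : E.Rules) :
    (∑ j ∈ E.jobs.filter (fun j => E.rej j = true), E.w j)
      ≤ ε * ∑ j ∈ E.jobs, E.w j := by
  obtain ⟨-, -, hcard, -, -, hrej, -⟩ := hE
  set R := E.jobs.filter (fun j => E.rej j = true)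
  set D : ℕ → Finset ℕ := fun k => E.jobs.filter (fun ℓ =>
    E.assign ℓ = E.assign k ∧ E.start k < E.r ℓ ∧ E.r ℓ ≤ E.C k)
  have hdisj : (R : Set ℕ).PairwiseDisjoint D := by
    intro j hj k hk hjk
    obtain ⟨hjJ, hjr⟩ := Finset.mem_filter.mp (Finset.mem_coe.mp hj)
    obtain ⟨hkJ, hkr⟩ := Finset.mem_filter.mp (Finset.mem_coe.mp hk)
    refine Finset.disjoint_left.mpr fun ℓ hℓj hℓk => hjk ?_
    obtain ⟨-, haj, hj₁, hj₂⟩ := Finset.mem_filter.mp hℓj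
    obtain ⟨-, hak, hk₁, hk₂⟩ := Finset.mem_filter.mp hℓk
    exact E.eq_of_mem_execution (hcard (E.assign ℓ)) hjJ hkJ haj.symm hak.symm
      (E.rej_running j hjJ hjr).1 (E.rej_running k hkJ hkr).1 hj₁ hj₂ hk₁ hk₂
  calc ∑ j ∈ R, E.w j ≤ ∑ j ∈ R, ε * ∑ ℓ ∈ D j, E.w ℓ := by
        refine Finset.sum_le_sum fun k hk => ?_
        obtain ⟨hkJ, hkr⟩ := Finset.mem_filter.mp hk
        exact ((div_lt_iff₀' hε0).mp (hrej k hkJ hkr).2.1).le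
    _ = ε * ∑ ℓ ∈ R.biUnion D, E.w ℓ := by
        rw [← Finset.mul_sum, Finset.sum_biUnion hdisj]
    _ ≤ ε * ∑ j ∈ E.jobs, E.w j := by
        refine mul_le_mul_of_nonneg_left ?_ hε0.le
        refine Finset.sum_le_sum_of_subset_of_nonneg ?_ fun j hj _ => (E.w_pos j hj).le
        exact Finset.biUnion_subset.mpr fun k _ => Finset.filter_subset _ _
end
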